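/- arXiv:2405.04823 — 6 statements merged into one kernel-verified Lean document; each statement's English description precedes it below -/
import Mathlib

section
/- Let G be a finite simple graph and let Q be an s-defective clique of G with |Q| = q such that q − 2 ≥ s. Then the subgraph of G induced by Q has diameter at most 2; that is, any two distinct vertices u, v ∈ Q are either adjacent in G or have a common neighbor w ∈ Q \ {u, v} that is adjacent to both u and v. -/
open Finset

variable {V : Type*} [Fintype V] [DecidableEq V]

/-- `E(Q)`: the edges of `G` with both endpoints in `Q`. -/
def edgesIn (G : SimpleGraph V) [DecidableRel G.Adj] (Q : Finset V) : Finset (Sym2 V) :=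
  G.edgeFinset ∩ Q.sym2

/-- `m̄(Q) = C(|Q|,2) - |E(Q)|`: the number of missing edges of `Q`. -/
def mbar (G : SimpleGraph V) [DecidableRel G.Adj] (Q : Finset V) : ℕ :=
  Q.card.choose 2 - (edgesIn G Q).card

/-- `m̄(u,Q) = |Q \ {u}| - |N(u) ∩ Q|`: the number of non-neighbors of `u` in `Q \ {u}`. -/
def mbarV (G : SimpleGraph V) [DecidableRel G.Adj] (u : V) (Q : Finset V) : ℕ :=
  (Q.erase u).card - (Q.filter (fun v => G.Adj u v)).card

/-- A family of distinct missing edges of `Q` has at most `m̄(Q)` members. -/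
theorem card_le_mbar_of_injOn (G : SimpleGraph V) [DecidableRel G.Adj] {Q A : Finset V}
    {f : V → Sym2 V} (hf : Set.InjOn f A) (hfQ : ∀ w ∈ A, f w ∈ Q.offDiag.image Sym2.mk.uncurry)
    (hfG : ∀ w ∈ A, f w ∉ G.edgeSet) : A.card ≤ mbar G Q := by
  have hsub : edgesIn G Q ⊆ Q.offDiag.image Sym2.mk.uncurry := by
    intro e
    induction e with
    | _ a b =>
      simp only [edgesIn, mem_inter, SimpleGraph.mem_edgeFinset, SimpleGraph.mem_edgeSet,
        mk_mem_sym2_iff, mem_image, mem_offDiag]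
      rintro ⟨hab, ha, hb⟩
      exact ⟨(a, b), ⟨ha, hb, hab.ne⟩, rfl⟩
  have himage : A.image f ⊆ Q.offDiag.image Sym2.mk.uncurry \ edgesIn G Q := by
    intro e he
    obtain ⟨w, hw, rfl⟩ := mem_image.mp he
    refine mem_sdiff.mpr ⟨hfQ w hw, fun h => hfG w hw ?_⟩
    exact SimpleGraph.mem_edgeFinset.mp (mem_inter.mp h).1
  have hle := card_le_card himage
  rwa [card_image_of_injOn hf, card_sdiff_of_subset hsub, Sym2.card_image_offDiag] at hle

theorem dclique_diameter_two (G : SimpleGraph V) [DecidableRel G.Adj] (s q : ℕ)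
    (Q : Finset V) (hcard : Q.card = q) (hQ : mbar G Q ≤ s) (hq : s + 2 ≤ q) :
    ∀ u ∈ Q, ∀ v ∈ Q, u ≠ v →
      G.Adj u v ∨ ∃ w ∈ Q, w ≠ u ∧ w ≠ v ∧ G.Adj u w ∧ G.Adj v w := by
  intro u hu v hv huv
  by_contra! h
  obtain ⟨hadj, hcommon⟩ := h
  have hle : (Q.erase u).card ≤ mbar G Q := by
    refine card_le_mbar_of_injOn G
      (f := fun w => if G.Adj u w then s(v, w) else s(u, w)) ?_ ?_ ?_
    · intro a ha b hb hab
      simp only [coe_erase, Set.mem_sdiff, mem_coe, Set.mem_singleton_iff] at ha hb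
      grind [Sym2.eq_iff]
    · intro w hw
      obtain ⟨hwu, hwQ⟩ := mem_erase.mp hw
      split_ifs with huw
      · have hvw : v ≠ w := by rintro rfl; exact hadj huw
        exact mem_image.mpr ⟨(v, w), mem_offDiag.mpr ⟨hv, hwQ, hvw⟩, rfl⟩
      · exact mem_image.mpr ⟨(u, w), mem_offDiag.mpr ⟨hu, hwQ, hwu.symm⟩, rfl⟩
    · intro w hw
      obtain ⟨hwu, hwQ⟩ := mem_erase.mp hw
      split_ifs with huw
      · have hwv : w ≠ v := by rintro rfl; exact hadj huw
        exact hcommon w hwQ hwu hwv huw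
      · exact huw
  rw [card_erase_of_mem hu] at hle
  omega
end

section
/- Let G be a finite simple graph and let Q be an s-plex of G with |Q| = q such that q ≥ 2s + 1. Then the subgraph of G induced by Q has diameter at most 2; that is, any two distinct vertices u, v ∈ Q are either adjacent in G or have a common neighbor w ∈ Q \ {u, v} that is adjacent to both u and v. -/
open Finset

variable {V : Type*} [Fintype V] [DecidableEq V]

theorem plex_diameter_two (G : SimpleGraph V) [DecidableRel G.Adj] (s q : ℕ)
    (Q : Finset V) (hcard : Q.card = q) (hQ : ∀ u ∈ Q, mbarV G u Q ≤ s)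
    (hq : 2 * s + 1 ≤ q) :
    ∀ u ∈ Q, ∀ v ∈ Q, u ≠ v →
      G.Adj u v ∨ ∃ w ∈ Q, w ≠ u ∧ w ≠ v ∧ G.Adj u w ∧ G.Adj v w := by
  intro u hu v hv huv
  by_contra! h
  obtain ⟨hadj, hno⟩ := h
  have hu' := hQ u hu
  have hv' := hQ v hv
  unfold mbarV at hu' hv'
  rw [card_erase_of_mem hu] at hu'
  rw [card_erase_of_mem hv] at hv'
  have hdisj : Disjoint (Q.filter (fun w => G.Adj u w)) (Q.filter (fun w => G.Adj v w)) := by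
    rw [disjoint_filter]
    intro w hw huw hvw
    exact hno w hw huw.ne' hvw.ne' huw hvw
  have hsub : Q.filter (fun w => G.Adj u w) ∪ Q.filter (fun w => G.Adj v w) ⊆
      (Q.erase u).erase v := by
    intro w hw
    simp only [mem_union, mem_filter] at hw
    simp only [mem_erase]
    rcases hw with ⟨hw, huw⟩ | ⟨hw, hvw⟩
    · exact ⟨fun e => hadj (e ▸ huw), huw.ne', hw⟩
    · exact ⟨hvw.ne', fun e => hadj (e ▸ hvw).symm, hw⟩
  have hle := card_le_card hsub
  rw [card_union_of_disjoint hdisj, card_erase_of_mem (mem_erase.2 ⟨huv.symm, hv⟩),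
    card_erase_of_mem hu] at hle
  have htwo : 1 < Q.card := one_lt_card.2 ⟨u, hu, v, hv, huv⟩
  omega
end

section
/- Let G be a finite simple graph, let R and H be disjoint finite vertex sets with |H| = q − |R| (so |R ∪ H| = q), and suppose H induces a clique in G (every two distinct vertices of H are adjacent). If Σ_{u ∈ H} m̄(u, R) ≤ s − m̄(R), then R ∪ H is an s-defective clique of size q, i.e., m̄(R ∪ H) ≤ s. -/
open Finset

variable {V : Type*} [Fintype V] [DecidableEq V]

/-- Adding a vertex `u` to `Q` adds an edge for each neighbor of `u` in `Q`. -/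
theorem card_edgesIn_add_le_card_edgesIn_insert (G : SimpleGraph V) [DecidableRel G.Adj]
    {u : V} {Q : Finset V} (hu : u ∉ Q) :
    (edgesIn G Q).card + (Q.filter (fun v => G.Adj u v)).card ≤
      (edgesIn G (insert u Q)).card := by
  rw [← card_image_of_injective (Q.filter (fun v => G.Adj u v))
    (f := fun v => s(u, v)) (fun _ _ h => Sym2.congr_right.mp h), ← card_union_of_disjoint]
  · refine card_le_card (union_subset ?_ ?_)
    · exact inter_subset_inter_left (sym2_mono (subset_insert u Q))
    · intro e he
      obtain ⟨v, hv, rfl⟩ := mem_image.mp he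
      rw [mem_filter] at hv
      simp [edgesIn, hv.1, hv.2]
  · rw [disjoint_left]
    intro e he he'
    obtain ⟨v, -, rfl⟩ := mem_image.mp he'
    exact hu (mk_mem_sym2_iff.mp (mem_inter.mp he).2).1

theorem mbar_insert_le (G : SimpleGraph V) [DecidableRel G.Adj]
    {u : V} {Q : Finset V} (hu : u ∉ Q) :
    mbar G (insert u Q) ≤ mbarV G u Q + mbar G Q := by
  have h := card_edgesIn_add_le_card_edgesIn_insert G hu
  have hchoose : (Q.card + 1).choose 2 = Q.card + Q.card.choose 2 := by
    rw [Nat.choose_succ_succ' Q.card 1, Nat.choose_one_right]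
  simp only [mbar, mbarV, card_insert_of_notMem hu, erase_eq_of_notMem hu, hchoose]
  omega

/-- Vertices adjacent to `u` do not change the number of non-neighbors of `u`. -/
theorem mbarV_union_of_forall_adj (G : SimpleGraph V) [DecidableRel G.Adj]
    {u : V} {R H : Finset V} (hdisj : Disjoint R H) (hadj : ∀ v ∈ H, G.Adj u v) :
    mbarV G u (R ∪ H) = mbarV G u R := by
  have huH : u ∉ H := fun h => G.loopless.irrefl u (hadj u h)
  rw [mbarV, mbarV, erase_union_distrib, erase_eq_of_notMem huH, filter_union,
    filter_true_of_mem hadj, card_union_of_disjoint (hdisj.mono_left (erase_subset u R)),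
    card_union_of_disjoint (hdisj.mono_left (filter_subset _ R)), Nat.add_sub_add_right]

theorem mbar_union_le_of_clique (G : SimpleGraph V) [DecidableRel G.Adj]
    {R H : Finset V} (hdisj : Disjoint R H)
    (hclique : ∀ x ∈ H, ∀ y ∈ H, x ≠ y → G.Adj x y) :
    mbar G (R ∪ H) ≤ (∑ u ∈ H, mbarV G u R) + mbar G R := by
  induction H using Finset.induction_on with
  | empty => simp
  | insert u H hu ih =>
    obtain ⟨huR, hRH⟩ := disjoint_insert_right.mp hdisj
    have hadj : ∀ v ∈ H, G.Adj u v := fun v hv =>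
      hclique u (mem_insert_self u H) v (mem_insert_of_mem hv) (ne_of_mem_of_not_mem hv hu).symm
    have hrec := ih hRH fun x hx y hy =>
      hclique x (mem_insert_of_mem hx) y (mem_insert_of_mem hy)
    have hstep := mbar_insert_le G (u := u) (Q := R ∪ H) (by simp [huR, hu])
    rw [mbarV_union_of_forall_adj G hRH hadj] at hstep
    rw [union_insert, sum_insert hu]
    omega

theorem dclique_from_clique_knapsack (G : SimpleGraph V) [DecidableRel G.Adj]
    (s q : ℕ) (R H : Finset V) (hdisj : Disjoint R H) (hcard : R.card + H.card = q)
    (hclique : ∀ x ∈ H, ∀ y ∈ H, x ≠ y → G.Adj x y)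
    (hsum : (∑ u ∈ H, mbarV G u R) + mbar G R ≤ s) :
    mbar G (R ∪ H) ≤ s ∧ (R ∪ H).card = q := by
  exact ⟨(mbar_union_le_of_clique G hdisj hclique).trans hsum,
    (card_union_of_disjoint hdisj).trans hcard⟩
end

section
/- Let G be a finite simple graph, let R and C be disjoint finite vertex sets, and let u be a vertex not in R ∪ C with m̄(R ∪ {u}) ≤ s. Define ω(u, R, C) as the largest integer k such that there exists a subset S ⊆ N(u) ∩ C with |S| = k and Σ_{v ∈ S} m̄(v, R) ≤ s − m̄(R ∪ {u}), and define γ_d(u, R, C) = |R ∪ {u}| + min{s − m̄(R ∪ {u}), m̄(u, C)} + ω(u, R, C), where m̄(u, C) = |C| − |N(u) ∩ C|. Then every s-defective clique Q of G with R ∪ {u} ⊆ Q ⊆ R ∪ {u} ∪ C satisfies |Q| ≤ γ_d(u, R, C). -/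
open Finset

variable {V : Type*} [Fintype V] [DecidableEq V]

theorem mbarV_eq_card_filter (G : SimpleGraph V) [DecidableRel G.Adj] (v : V) (Q : Finset V) :
    mbarV G v Q = ((Q.erase v).filter (fun w => ¬ G.Adj v w)).card := by
  have hsub : Q.filter (fun w => G.Adj v w) = (Q.erase v).filter (fun w => G.Adj v w) := by
    ext w
    simp only [mem_filter, mem_erase]
    exact ⟨fun h => ⟨⟨h.2.ne', h.1⟩, h.2⟩, fun h => ⟨h.1.2, h.2⟩⟩
  have hcard := card_filter_add_card_filter_not (s := Q.erase v) (fun w => G.Adj v w)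
  rw [mbarV, hsub]
  omega

theorem mbarV_mono (G : SimpleGraph V) [DecidableRel G.Adj] (v : V) {P Q : Finset V}
    (h : P ⊆ Q) : mbarV G v P ≤ mbarV G v Q := by
  rw [mbarV_eq_card_filter, mbarV_eq_card_filter]
  exact card_le_card (filter_subset_filter _ (erase_subset_erase v h))

theorem card_edgesIn_insert (G : SimpleGraph V) [DecidableRel G.Adj] {v : V} {Q : Finset V}
    (hv : v ∉ Q) :
    (edgesIn G (insert v Q)).card =
      (edgesIn G Q).card + (Q.filter (fun w => G.Adj v w)).card := by
  have hinsert : edgesIn G (insert v Q) =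
      edgesIn G Q ∪ (Q.filter (fun w => G.Adj v w)).image (fun w => s(v, w)) := by
    ext e
    induction e using Sym2.ind with
    | _ a b =>
      simp only [edgesIn, mem_inter, SimpleGraph.mem_edgeFinset, SimpleGraph.mem_edgeSet,
        mk_mem_sym2_iff, mem_insert, mem_union, mem_image, mem_filter, Sym2.eq_iff]
      constructor
      · rintro ⟨hab, rfl | ha, rfl | hb⟩
        · exact (G.irrefl hab).elim
        · exact Or.inr ⟨b, ⟨hb, hab⟩, Or.inl ⟨rfl, rfl⟩⟩
        · exact Or.inr ⟨a, ⟨ha, hab.symm⟩, Or.inr ⟨rfl, rfl⟩⟩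
        · exact Or.inl ⟨hab, ha, hb⟩
      · rintro (⟨hab, ha, hb⟩ | ⟨w, ⟨hw, hvw⟩, ⟨rfl, rfl⟩ | ⟨rfl, rfl⟩⟩)
        · exact ⟨hab, Or.inr ha, Or.inr hb⟩
        · exact ⟨hvw, Or.inl rfl, Or.inr hw⟩
        · exact ⟨hvw.symm, Or.inr hw, Or.inl rfl⟩
  rw [hinsert, card_union_of_disjoint, card_image_of_injective]
  · intro a b hab
    exact Sym2.congr_right.mp hab
  · rw [disjoint_left]
    intro e he he'
    obtain ⟨w, -, rfl⟩ := mem_image.mp he'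
    exact hv (mk_mem_sym2_iff.mp (mem_inter.mp he).2).1

theorem card_edgesIn_le_choose_two (G : SimpleGraph V) [DecidableRel G.Adj] (Q : Finset V) :
    (edgesIn G Q).card ≤ Q.card.choose 2 := by
  induction Q using Finset.induction_on with
  | empty => simp [edgesIn]
  | insert v Q hv ih =>
    have hfilter := card_filter_le Q (fun w => G.Adj v w)
    rw [card_edgesIn_insert G hv, card_insert_of_notMem hv,
      Nat.choose_succ_succ _ 1, Nat.succ_eq_add_one, one_add_one_eq_two,
      Nat.choose_one_right]
    omega

theorem mbar_insert (G : SimpleGraph V) [DecidableRel G.Adj] {v : V} {Q : Finset V}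
    (hv : v ∉ Q) : mbar G (insert v Q) = mbar G Q + mbarV G v Q := by
  have hfilter := card_filter_le Q (fun w => G.Adj v w)
  have hedges := card_edgesIn_le_choose_two G Q
  rw [mbar, mbar, mbarV, card_edgesIn_insert G hv, card_insert_of_notMem hv,
    Nat.choose_succ_succ _ 1, Nat.succ_eq_add_one, one_add_one_eq_two,
    Nat.choose_one_right, erase_eq_of_notMem hv]
  omega

theorem mbar_add_sum_mbarV_le_mbar_union (G : SimpleGraph V) [DecidableRel G.Adj]
    (P T : Finset V) (h : Disjoint P T) :
    mbar G P + ∑ v ∈ T, mbarV G v P ≤ mbar G (P ∪ T) := by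
  induction T using Finset.induction_on with
  | empty => simp
  | insert v T hv ih =>
    rw [disjoint_insert_right] at h
    have hmono := mbarV_mono G v (subset_union_left : P ⊆ P ∪ T)
    have hT := ih h.2
    rw [sum_insert hv, union_insert, mbar_insert G (by simp [h.1, hv])]
    omega

theorem dclique_size_upper_bound (G : SimpleGraph V) [DecidableRel G.Adj]
    (s : ℕ) (R C : Finset V) (u : V) (hdisj : Disjoint R C) (hu : u ∉ R ∪ C)
    (hRu : mbar G (insert u R) ≤ s) (ω : ℕ)
    (hω : IsGreatest {k : ℕ | ∃ S ⊆ C.filter (fun v => G.Adj u v), S.card = k ∧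
      (∑ v ∈ S, mbarV G v R) + mbar G (insert u R) ≤ s} ω)
    (Q : Finset V) (hQ : mbar G Q ≤ s)
    (h1 : insert u R ⊆ Q) (h2 : Q ⊆ insert u (R ∪ C)) :
    Q.card ≤ (insert u R).card + min (s - mbar G (insert u R)) (mbarV G u C) + ω := by
  have hT : Q \ insert u R ⊆ C := by
    intro v hv
    have hv' := mem_sdiff.mp hv
    have := h2 hv'.1
    simp only [mem_insert, mem_union] at this hv'
    tauto
  have huT : u ∉ Q \ insert u R := by simp
  set T := Q \ insert u R with hTdef
  set A := T.filter (fun v => G.Adj u v)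
  set B := T.filter (fun v => ¬ G.Adj u v)
  have hcardT : A.card + B.card = T.card := card_filter_add_card_filter_not _
  have hcardQ : T.card + (insert u R).card = Q.card := card_sdiff_add_card_eq_card h1
  have hmissing : mbar G (insert u R) + ∑ v ∈ T, mbarV G v (insert u R) ≤ s := by
    have := mbar_add_sum_mbarV_le_mbar_union G (insert u R) T disjoint_sdiff
    rw [hTdef, union_sdiff_of_subset h1] at this
    exact this.trans hQ
  have hsplit : ∑ v ∈ A, mbarV G v (insert u R) + ∑ v ∈ B, mbarV G v (insert u R) =
      ∑ v ∈ T, mbarV G v (insert u R) := sum_filter_add_sum_filter_not _ _ _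
  have hA : ∑ v ∈ A, mbarV G v R ≤ ∑ v ∈ A, mbarV G v (insert u R) :=
    sum_le_sum fun v _ => mbarV_mono G v (subset_insert u R)
  have hB : B.card ≤ ∑ v ∈ B, mbarV G v (insert u R) := by
    rw [card_eq_sum_ones]
    refine sum_le_sum fun v hv => ?_
    obtain ⟨hvT, huv⟩ := mem_filter.mp hv
    rw [mbarV_eq_card_filter, Nat.one_le_iff_ne_zero, card_ne_zero]
    exact ⟨u, mem_filter.mpr ⟨mem_erase.mpr ⟨fun h => huT (h ▸ hvT), mem_insert_self u R⟩,
      fun h => huv h.symm⟩⟩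
  have hBC : B.card ≤ mbarV G u C := by
    rw [mbarV_eq_card_filter]
    exact card_le_card (filter_subset_filter _ (subset_erase.mpr ⟨hT, huT⟩))
  have hAω : A.card ≤ ω :=
    hω.2 ⟨A, filter_subset_filter _ hT, rfl, by omega⟩
  omega
end

section
/- Let G be a finite simple graph, let R be a finite vertex set, and let Q be an s-plex of G with R ⊆ Q. Then Σ_{v ∈ Q \ R} m̄(v, R) ≤ Σ_{w ∈ R} (s − m̄(w, R)), where m̄(v, R) = |R \ {v}| − |N(v) ∩ R| is the number of non-neighbors of v in R \ {v}. -/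
open Finset

variable {V : Type*} [Fintype V] [DecidableEq V]

/-- `m̄(u,Q)` is the number of neighbors of `u` in `Q` in the complement graph. -/
theorem mbarV_eq_card_filter_compl_adj (G : SimpleGraph V) [DecidableRel G.Adj]
    (u : V) (Q : Finset V) : mbarV G u Q = #{v ∈ Q | Gᶜ.Adj u v} := by
  have hfilter : ({v ∈ Q | Gᶜ.Adj u v} : Finset V) = Q.erase u \ {v ∈ Q | G.Adj u v} := by
    ext v
    simp only [mem_filter, mem_sdiff, mem_erase, SimpleGraph.compl_adj]
    grind
  have hsub : ({v ∈ Q | G.Adj u v} : Finset V) ⊆ Q.erase u := by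
    intro v hv
    rw [mem_filter] at hv
    exact mem_erase.2 ⟨hv.2.ne', hv.1⟩
  rw [hfilter, card_sdiff_of_subset hsub, mbarV]

/-- `m̄(u,·)` is additive along a subset and its relative complement. -/
theorem mbarV_sdiff_add_mbarV (G : SimpleGraph V) [DecidableRel G.Adj]
    (u : V) {R Q : Finset V} (hsub : R ⊆ Q) :
    mbarV G u (Q \ R) + mbarV G u R = mbarV G u Q := by
  simp only [mbarV_eq_card_filter_compl_adj, card_filter]
  exact sum_sdiff hsub

/-- Double counting of the non-adjacent pairs between two vertex sets. -/
theorem sum_mbarV_comm (G : SimpleGraph V) [DecidableRel G.Adj] (A B : Finset V) :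
    ∑ v ∈ A, mbarV G v B = ∑ w ∈ B, mbarV G w A := by
  simp only [mbarV_eq_card_filter_compl_adj, card_filter]
  rw [sum_comm]
  simp only [SimpleGraph.adj_comm]

theorem plex_nonneighbor_sum_bound (G : SimpleGraph V) [DecidableRel G.Adj]
    (s : ℕ) (R Q : Finset V) (hsub : R ⊆ Q) (hQ : ∀ u ∈ Q, mbarV G u Q ≤ s) :
    (∑ v ∈ Q \ R, (mbarV G v R : ℤ)) ≤ ∑ w ∈ R, ((s : ℤ) - mbarV G w R) := by
  rw [← Nat.cast_sum, sum_mbarV_comm, Nat.cast_sum]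
  refine sum_le_sum fun w hw => ?_
  have hadd := mbarV_sdiff_add_mbarV G w hsub
  have hle := hQ w (hsub hw)
  omega
end

section
/- Let G be a finite simple graph, let R and C be disjoint finite vertex sets, and let u be a vertex with u ∉ R ∪ C. Suppose that for every vertex v' ∈ C the set R ∪ {v'} is an s-plex. Let v ∈ C and let w ∈ R be a vertex that is not adjacent to v and satisfies m̄(w, R ∪ {u}) = s. Then w is not adjacent to u. -/
open Finset

variable {V : Type*} [Fintype V] [DecidableEq V]

theorem plex_saturated_nonneighbor (G : SimpleGraph V) [DecidableRel G.Adj]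
    (s : ℕ) (R C : Finset V) (u : V) (hdisj : Disjoint R C) (hu : u ∉ R ∪ C)
    (hinv : ∀ v' ∈ C, ∀ w ∈ insert v' R, mbarV G w (insert v' R) ≤ s)
    (v : V) (hv : v ∈ C) (w : V) (hw : w ∈ R) (hwv : ¬ G.Adj w v)
    (hws : mbarV G w (insert u R) = s) :
    ¬ G.Adj w u := by
  intro hwu
  have hvR : v ∉ R := fun h => Finset.disjoint_left.mp hdisj h hv
  have huR : u ∉ R := fun h => hu (Finset.mem_union_left C h)
  have hsv := hinv v hv w (Finset.mem_insert_of_mem hw)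
  have hsub : R.filter (fun x => G.Adj w x) ⊆ R.erase w := fun x hx =>
    Finset.mem_erase.mpr ⟨(Finset.mem_filter.mp hx).2.ne', (Finset.mem_filter.mp hx).1⟩
  have hcard := Finset.card_le_card hsub
  rw [Finset.card_erase_of_mem hw] at hcard
  have hpos : 0 < R.card := Finset.card_pos.mpr ⟨w, hw⟩
  rw [mbarV, Finset.card_erase_of_mem (Finset.mem_insert_of_mem hw),
    Finset.card_insert_of_notMem hvR, Finset.filter_insert, if_neg hwv] at hsv
  rw [mbarV, Finset.card_erase_of_mem (Finset.mem_insert_of_mem hw),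
    Finset.card_insert_of_notMem huR, Finset.filter_insert, if_pos hwu,
    Finset.card_insert_of_notMem (fun h => huR (Finset.mem_filter.mp h).1)] at hws
  omega
end
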